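/- Let L = 3 and let n ≥ 1 be an integer. For an integer i define g_i(β) = ∫_{e^{−iL}}^{e^{−(i−1)L}} r^{β−1} dr (so g_i(0) = L and g_i(β) = β^{−1} e^{−iβL}(e^{βL} − 1) for β ≠ 0), and let M_i be the symmetric 4×4 real matrix with rows (g_i(2n), g_i(2n+2), g_i(0), g_i(−2)), (g_i(2n+2), g_i(2n+4), g_i(2), g_i(0)), (g_i(0), g_i(2), g_i(−2n), g_i(−2n−2)), (g_i(−2), g_i(0), g_i(−2n−2), g_i(−2n−4)). Then the matrix e^{−L}(M_{−1} + M_{1}) − 2·M_{0} is positive definite. -/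

import Mathlib

open Real Matrix
/-- A symmetric form in two pairs of variables with identical diagonal blocks is positive when the
diagonal blocks dominate the coupling between the pairs. -/
lemma coupled_quadratic_pos {a b c f k m l e₁ e₂ : ℝ} (hl : 0 < l)
    (h₁ : |f| + |k| / l ≤ e₁) (h₂ : |m| + |k| * l ≤ e₂) (ha : e₁ < a)
    (hdet : b ^ 2 < (a - e₁) * (c - e₂)) {x y z w : ℝ}
    (hne : x ≠ 0 ∨ y ≠ 0 ∨ z ≠ 0 ∨ w ≠ 0) :
    0 < (a * x ^ 2 + 2 * b * x * y + c * y ^ 2) + (a * z ^ 2 + 2 * b * z * w + c * w ^ 2)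
      + 2 * (f * x * z + k * (x * w + y * z) + m * y * w) := by
  have cross : ∀ q p v r : ℝ, 0 < r → -(|q| * (p ^ 2 / r + r * v ^ 2)) ≤ 2 * (q * p * v) := by
    intro q p v r hr
    have h : 2 * |p * v| ≤ p ^ 2 / r + r * v ^ 2 := by
      have e : p ^ 2 / r + r * v ^ 2 - 2 * |p * v| = (|p| - r * |v|) ^ 2 / r := by
        rw [abs_mul, ← sq_abs p, ← sq_abs v]
        field_simp
        ring
      have : 0 ≤ (|p| - r * |v|) ^ 2 / r := by positivity
      linarith
    have h' := mul_le_mul_of_nonneg_left h (abs_nonneg q)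
    have h'' := neg_abs_le (q * (p * v))
    rw [abs_mul] at h''
    linarith
  have block : ∀ p v : ℝ, 0 ≤ (a - e₁) * p ^ 2 + 2 * b * p * v + (c - e₂) * v ^ 2 ∧
      ((p ≠ 0 ∨ v ≠ 0) → 0 < (a - e₁) * p ^ 2 + 2 * b * p * v + (c - e₂) * v ^ 2) := by
    intro p v
    have hA : 0 < a - e₁ := by linarith
    have hD : 0 < (a - e₁) * (c - e₂) - b ^ 2 := by linarith
    have e : (a - e₁) * p ^ 2 + 2 * b * p * v + (c - e₂) * v ^ 2
        = (((a - e₁) * p + b * v) ^ 2 + ((a - e₁) * (c - e₂) - b ^ 2) * v ^ 2) / (a - e₁) := by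
      field_simp
      ring
    rw [e]
    refine ⟨by positivity, fun h => div_pos ?_ hA⟩
    by_cases hv : v = 0
    · have hp : p ≠ 0 := by simpa [hv] using h
      subst hv
      have : (a - e₁) * p ≠ 0 := mul_ne_zero hA.ne' hp
      have : 0 < ((a - e₁) * p + b * 0) ^ 2 := by
        rw [mul_zero, add_zero]
        positivity
      linarith
    · positivity
  have c₁ := cross f x z 1 one_pos
  have c₂ := cross k x w l hl
  have c₃ := cross k z y l hl
  have c₄ := cross m y w 1 one_pos
  have b₁ : (|f| + |k| / l) * (x ^ 2 + z ^ 2) ≤ e₁ * (x ^ 2 + z ^ 2) := by gcongr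
  have b₂ : (|m| + |k| * l) * (y ^ 2 + w ^ 2) ≤ e₂ * (y ^ 2 + w ^ 2) := by gcongr
  have e₃ : |k| * (x ^ 2 / l + l * w ^ 2) + |k| * (z ^ 2 / l + l * y ^ 2)
      = |k| / l * (x ^ 2 + z ^ 2) + |k| * l * (y ^ 2 + w ^ 2) := by ring
  have pos : 0 < ((a - e₁) * x ^ 2 + 2 * b * x * y + (c - e₂) * y ^ 2)
      + ((a - e₁) * z ^ 2 + 2 * b * z * w + (c - e₂) * w ^ 2) := by
    by_cases h : x ≠ 0 ∨ y ≠ 0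
    · exact add_pos_of_pos_of_nonneg ((block x y).2 h) (block z w).1
    · exact add_pos_of_nonneg_of_pos (block x y).1 ((block z w).2 (by tauto))
  simp only [div_one, one_mul] at c₁ c₄
  linarith

lemma setIntegral_Icc_exp_rpow_sub_one {p q : ℝ} (hpq : p ≤ q) {β : ℝ} (hβ : β ≠ 0) :
    ∫ r in Set.Icc (exp p) (exp q), r ^ (β - 1) = (exp (q * β) - exp (p * β)) / β := by
  rw [MeasureTheory.integral_Icc_eq_integral_Ioc,
    ← intervalIntegral.integral_of_le (exp_le_exp.2 hpq), integral_rpow]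
  · rw [sub_add_cancel, exp_mul, exp_mul]
  · refine Or.inr ⟨fun h => hβ (by linarith), fun h => ?_⟩
    rw [Set.uIcc_of_le (exp_le_exp.2 hpq)] at h
    exact absurd h.1 (not_le.2 (exp_pos p))

lemma setIntegral_Icc_exp_rpow_zero_sub_one {p q : ℝ} (hpq : p ≤ q) :
    ∫ r in Set.Icc (exp p) (exp q), r ^ ((0 : ℝ) - 1) = q - p := by
  rw [MeasureTheory.integral_Icc_eq_integral_Ioc,
    ← intervalIntegral.integral_of_le (exp_le_exp.2 hpq)]
  simp only [zero_sub, rpow_neg_one]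
  rw [integral_inv_of_pos (exp_pos p) (exp_pos q), ← exp_sub, log_exp]

lemma exp_three_bounds : 20.08 < exp 3 ∧ exp 3 < 20.09 := by
  have h : exp 3 = exp 1 ^ 3 := by rw [← exp_nat_mul]; norm_num
  have h₁ := exp_one_gt_d9
  have h₂ := exp_one_lt_d9
  rw [h]
  constructor
  · calc (20.08 : ℝ) < 2.7182818283 ^ 3 := by norm_num
      _ < exp 1 ^ 3 := by gcongr
  · calc exp 1 ^ 3 < (2.7182818286 : ℝ) ^ 3 := by gcongr
      _ < 20.09 := by norm_num

/-- The relative deviation from the leading exponential of the entry with exponent `-β`, where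
`E = exp L` and `X = exp (L * β)`. -/
noncomputable def entryFactor (E X : ℝ) : ℝ := (1 - 1 / X) * (1 + 1 / X ^ 2 - 2 * E / X)

lemma entryFactor_bounds {E X : ℝ} (hE : 2 ≤ E) (hX : E ^ 2 ≤ X) :
    1 - (1 + 2 * E) / X ≤ entryFactor E X ∧ 0 ≤ entryFactor E X ∧ entryFactor E X ≤ 1 := by
  have hX4 : 4 ≤ X := by nlinarith
  have hX0 : 0 < X := by linarith
  have hu : 0 < 1 / X := by positivity
  have hu1 : 1 / X ≤ 1 := by rw [div_le_one hX0]; linarith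
  have hv1 : 2 * E / X ≤ 1 := by rw [div_le_one hX0]; nlinarith
  have e₁ : 1 / X ^ 2 = (1 / X) ^ 2 := by ring
  have e₂ : 2 * E / X = 2 * E * (1 / X) := by ring
  have e₃ : (1 + 2 * E) / X = 1 / X + 2 * E * (1 / X) := by ring
  unfold entryFactor
  rw [e₁, e₃]
  rw [e₂] at hv1 ⊢
  generalize 1 / X = u at *
  have hv0 : 0 ≤ 2 * E * u - u ^ 2 := by nlinarith
  refine ⟨?_, mul_nonneg (by linarith) (by nlinarith), ?_⟩
  · nlinarith
  · exact mul_le_one₀ (by linarith) (by nlinarith) (by linarith)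

lemma diagonal_dominance {ν E s A B C : ℝ} (hν : 1 ≤ ν) (hE₁ : 20.08 < E) (hE₂ : E < 20.09)
    (hs : (ν + 1) / 2 * E ≤ s)
    (hA : 1 - (1 + 2 * E) / s ^ 2 ≤ A) (hB₀ : 0 ≤ B) (hB : B ≤ 1)
    (hC : 1 - (1 + 2 * E) / (s ^ 2 * E ^ 4) ≤ C) :
    11.46 * E / s ^ 3 < A / ν ∧
      (B / (ν + 1)) ^ 2 <
        (A / ν - 11.46 * E / s ^ 3) * (C / (ν + 2) - 11.46 * E / s ^ 3) := by
  have hE : 0 < E := by linarith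
  have hν0 : 0 < ν := by linarith
  have hsE : E ≤ s := by nlinarith
  have hs0 : 0 < s := by linarith
  set N := ν + 1 with hN
  have hN0 : 0 < N := by linarith
  set ε := 11.46 * E / s ^ 3 with hε
  have hε0 : 0 < ε := by positivity
  have k₁ : N ^ 2 * ((1 + 2 * E) / s ^ 2) ≤ 4 * (1 + 2 * E) / E ^ 2 := by
    have : N / s ≤ 2 / E := by
      rw [div_le_div_iff₀ hs0 hE]; linarith
    calc N ^ 2 * ((1 + 2 * E) / s ^ 2) = (N / s) ^ 2 * (1 + 2 * E) := by ring
      _ ≤ (2 / E) ^ 2 * (1 + 2 * E) := by gcongr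
      _ = _ := by ring
  have k₂ : N ^ 3 * ε ≤ 91.68 / E ^ 2 := by
    have : N / s ≤ 2 / E := by
      rw [div_le_div_iff₀ hs0 hE]; linarith
    calc N ^ 3 * ε = (N / s) ^ 3 * (11.46 * E) := by rw [hε]; ring
      _ ≤ (2 / E) ^ 3 * (11.46 * E) := by gcongr
      _ = _ := by field_simp; norm_num
  have k₃ : 4 * (1 + 2 * E) / E ^ 2 ≤ 0.4085 := by
    rw [div_le_iff₀ (by positivity)]; nlinarith
  have k₄ : 91.68 / E ^ 2 ≤ 0.2275 := by
    rw [div_le_iff₀ (by positivity)]; nlinarith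
  set η := (1 + 2 * E) / s ^ 2 with hη
  have hη0 : 0 < η := by positivity
  have k₅ : (1 + 2 * E) / (s ^ 2 * E ^ 4) ≤ η * 0.01 := by
    have : (1 + 2 * E) / (s ^ 2 * E ^ 4) = η * (1 / E ^ 4) := by rw [hη]; field_simp
    rw [this]
    gcongr
    rw [div_le_iff₀ (by positivity)]
    have : (20 : ℝ) ^ 4 ≤ E ^ 4 := by gcongr; linarith
    linarith
  set a := η + ν * ε with ha
  set c := η * 0.01 + (ν + 2) * ε with hc
  have ha0 : 0 < a := by positivity
  have hc0 : 0 < c := by positivity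
  have hsum : N ^ 2 * (a + c) < 1 := by
    have : N ^ 2 * (a + c) = 1.01 * (N ^ 2 * η) + 2 * (N ^ 3 * ε) := by
      rw [ha, hc, hN]; ring
    rw [this]
    linarith
  have hac : a + c < 1 := by nlinarith
  have hA' : (1 - a) / ν ≤ A / ν - ε := by
    rw [div_le_iff₀ hν0, sub_mul, div_mul_cancel₀ _ hν0.ne']; linarith
  have hC' : (1 - c) / (ν + 2) ≤ C / (ν + 2) - ε := by
    rw [div_le_iff₀ (by linarith), sub_mul, div_mul_cancel₀ _ (by linarith)]; linarith
  have hA0 : 0 < (1 - a) / ν := div_pos (by linarith) hν0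
  have hC0 : 0 < (1 - c) / (ν + 2) := div_pos (by linarith) (by linarith)
  refine ⟨by linarith, ?_⟩
  calc (B / N) ^ 2 ≤ (1 / N) ^ 2 := by gcongr
    _ < (1 - a) / ν * ((1 - c) / (ν + 2)) := by
      rw [div_pow, one_pow, div_mul_div_comm, div_lt_div_iff₀ (by positivity) (by positivity)]
      have : ν * (ν + 2) = N ^ 2 - 1 := by rw [hN]; ring
      rw [this]
      have : 0 < N ^ 2 * (a * c) := by positivity
      nlinarith
    _ ≤ _ := by gcongr; linarith

lemma natCast_succ_div_two_mul_le_pow {n : ℕ} (hn : 1 ≤ n) {E : ℝ} (hE : 2 ≤ E) :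
    ((n : ℝ) + 1) / 2 * E ≤ E ^ n := by
  obtain ⟨m, rfl⟩ := Nat.exists_eq_add_of_le' hn
  have h : 1 + (m : ℝ) * 1 ≤ (1 + 1) ^ m := one_add_mul_le_pow (by norm_num) m
  have h' : ((1 : ℝ) + 1) ^ m ≤ E ^ m := by gcongr; linarith
  have : (0 : ℝ) ≤ m := m.cast_nonneg
  rw [pow_succ]
  push_cast
  gcongr
  linarith

lemma scaled_form_pos {ν E s f k a b c : ℝ} (hν : 1 ≤ ν) (hE₁ : 20.08 < E) (hE₂ : E < 20.09)
    (hsN : (ν + 1) / 2 * E ≤ s) (hf : |f| ≤ 5.702) (hk : 0 ≤ k ∧ k ≤ E / 2)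
    (ha : a = s ^ 2 / (2 * E) * (entryFactor E (s ^ 2) / ν))
    (hb : b = s ^ 2 / (2 * E) * E ^ 2 * (entryFactor E (s ^ 2 * E ^ 2) / (ν + 1)))
    (hc : c = s ^ 2 / (2 * E) * E ^ 4 * (entryFactor E (s ^ 2 * E ^ 4) / (ν + 2)))
    {x y z w : ℝ} (hne : x ≠ 0 ∨ y ≠ 0 ∨ z ≠ 0 ∨ w ≠ 0) :
    0 < (a * x ^ 2 + 2 * b * x * y + c * y ^ 2) + (a * z ^ 2 + 2 * b * z * w + c * w ^ 2)
      + 2 * (f / s * x * z + k / s * (x * w + y * z) + f / (s * E ^ 2) * y * w) := by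
  have hE0 : 0 < E := by linarith
  have hsE : E ≤ s := by nlinarith
  have hs0 : 0 < s := by linarith
  have hE1 : 1 ≤ E := by linarith
  have hs2 : E ^ 2 ≤ s ^ 2 := by gcongr
  have hA := entryFactor_bounds (by linarith : 2 ≤ E) hs2
  have hB := entryFactor_bounds (X := s ^ 2 * E ^ 2) (by linarith : 2 ≤ E)
    (hs2.trans (le_mul_of_one_le_right (by positivity) (one_le_pow₀ hE1)))
  have hC := entryFactor_bounds (X := s ^ 2 * E ^ 4) (by linarith : 2 ≤ E)
    (hs2.trans (le_mul_of_one_le_right (by positivity) (one_le_pow₀ hE1)))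
  obtain ⟨hd₁, hd₂⟩ := diagonal_dominance hν hE₁ hE₂ hsN hA.1 hB.2.1 hB.2.2 hC.1
  have hε : 5.73 / s = s ^ 2 / (2 * E) * (11.46 * E / s ^ 3) := by
    field_simp; norm_num
  refine coupled_quadratic_pos (l := E ^ 2) (e₁ := 5.73 / s) (e₂ := E ^ 4 * (5.73 / s))
    (by positivity) ?_ ?_ ?_ ?_ hne
  · rw [abs_div, abs_div, abs_of_pos hs0, abs_of_nonneg hk.1, div_right_comm, ← add_div]
    gcongr
    have : k / E ^ 2 ≤ 0.028 := by
      rw [div_le_iff₀ (by positivity)]; nlinarith [hk.2]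
    linarith
  · rw [abs_div, abs_div, abs_of_pos hs0, abs_of_nonneg hk.1,
      abs_of_pos (by positivity : 0 < s * E ^ 2)]
    have e : |f| / (s * E ^ 2) + k / s * E ^ 2 = (|f| / E ^ 2 + k * E ^ 2) / s := by
      field_simp
    rw [e, ← mul_div_assoc]
    gcongr
    have h₁ : |f| / E ^ 2 ≤ 5.702 :=
      (div_le_self (abs_nonneg _) (one_le_pow₀ hE1)).trans hf
    have h₂ : k * E ^ 2 ≤ E ^ 2 * E ^ 2 := by
      gcongr; nlinarith [hk.2]
    have h₃ : 2 ≤ E ^ 2 * E ^ 2 := by nlinarith [one_le_pow₀ (n := 2) hE1]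
    linarith
  · rw [hε, ha]
    gcongr
  · rw [hε, ha, hb, hc]
    have h := mul_lt_mul_of_pos_left hd₂ (by positivity : 0 < (s ^ 2 / (2 * E) * E ^ 2) ^ 2)
    refine lt_of_eq_of_lt (by ring) (h.trans_eq (by ring))

set_option maxHeartbeats 1000000 in
/-- With `L = 3` and an integer `n ≥ 1`, let `g i β = ∫_{e^{-iL}}^{e^{-(i-1)L}} r^{β-1} dr`
and let `M i` be the Gram matrix of the four radial modes `rⁿ, r^{n+2}, r^{-n}, r^{-n-2}`
with respect to the weighted pairing `∫ f² r⁻¹ dr`. Then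
`e^{-L}(M₋₁ + M₁) - 2 M₀` is positive definite. -/
theorem gram_matrix_posDef (n : ℕ) (hn : 1 ≤ n)
    (g : ℤ → ℝ → ℝ)
    (hg : ∀ (i : ℤ) (β : ℝ), g i β =
      ∫ r in Set.Icc (Real.exp (-(i : ℝ) * 3)) (Real.exp (-((i : ℝ) - 1) * 3)), r ^ (β - 1))
    (M : ℤ → Matrix (Fin 4) (Fin 4) ℝ)
    (hM : ∀ i : ℤ, M i =
      !![g i (2 * n), g i (2 * n + 2), g i 0, g i (-2);
         g i (2 * n + 2), g i (2 * n + 4), g i 2, g i 0;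
         g i 0, g i 2, g i (-(2 * n)), g i (-(2 * n) - 2);
         g i (-2), g i 0, g i (-(2 * n) - 2), g i (-(2 * n) - 4)]) :
    (Real.exp (-3) • (M (-1) + M 1) - (2 : ℝ) • M 0).PosDef := by
  obtain ⟨hE₁, hE₂⟩ := exp_three_bounds
  set E := exp 3 with hE
  have hE0 : 0 < E := by linarith
  have hn0 : (1 : ℝ) ≤ n := by exact_mod_cast hn
  set s := E ^ n with hs
  have hsN : ((n : ℝ) + 1) / 2 * E ≤ s := natCast_succ_div_two_mul_le_pow hn (by linarith)
  have hs0 : 0 < s := by positivity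
  have hEinv : exp (-3) = 1 / E := by rw [exp_neg, one_div]
  have hexp : ∀ k : ℕ, exp (3 * (2 * n + 2 * k)) = s ^ 2 * E ^ (2 * k) := by
    intro k
    rw [hs, hE, ← pow_mul, ← pow_add, ← exp_nat_mul]
    push_cast
    ring_nf
  let F : ℝ → ℝ := fun β => exp (-3) * (g (-1) β + g 1 β) - 2 * g 0 β
  let G : ℝ → ℝ := fun β => exp (3 * β) / (E * β) * entryFactor E (exp (3 * β))
  have hF_neg : ∀ β : ℝ, β ≠ 0 → F (-β) = G β := by
    intro β hβ
    have hX := (exp_pos (3 * β)).ne'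
    simp only [F, G, hg, entryFactor]
    rw [setIntegral_Icc_exp_rpow_sub_one (by norm_num) (neg_ne_zero.2 hβ),
      setIntegral_Icc_exp_rpow_sub_one (by norm_num) (neg_ne_zero.2 hβ),
      setIntegral_Icc_exp_rpow_sub_one (by norm_num) (neg_ne_zero.2 hβ), hEinv]
    have e₁ : exp (-(3 * β)) = 1 / exp (3 * β) := by rw [exp_neg, one_div]
    have e₂ : exp (-(6 * β)) = 1 / exp (3 * β) ^ 2 := by
      rw [← exp_nat_mul, one_div, ← exp_neg]; push_cast; ring_nf
    norm_num
    ring_nf at e₁ e₂ ⊢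
    rw [e₁, e₂]
    field_simp
    ring
  have hF_pos : ∀ β : ℝ, β ≠ 0 → F β = exp (3 * β) * G β := by
    intro β hβ
    have hX := (exp_pos (3 * β)).ne'
    simp only [F, G, hg, entryFactor]
    rw [setIntegral_Icc_exp_rpow_sub_one (by norm_num) hβ,
      setIntegral_Icc_exp_rpow_sub_one (by norm_num) hβ,
      setIntegral_Icc_exp_rpow_sub_one (by norm_num) hβ, hEinv]
    have e₁ : exp (-(3 * β)) = 1 / exp (3 * β) := by rw [exp_neg, one_div]
    have e₂ : exp (6 * β) = exp (3 * β) ^ 2 := by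
      rw [← exp_nat_mul]; push_cast; ring_nf
    norm_num
    ring_nf at e₁ e₂ ⊢
    rw [e₁, e₂]
    field_simp
    ring
  have hF_zero : F 0 = 6 / E - 6 := by
    simp only [F, hg]
    rw [setIntegral_Icc_exp_rpow_zero_sub_one (by norm_num),
      setIntegral_Icc_exp_rpow_zero_sub_one (by norm_num),
      setIntegral_Icc_exp_rpow_zero_sub_one (by norm_num), hEinv]
    norm_num
    ring
  have hF_two : F 2 = E ^ 2 * G 2 := by
    rw [hF_pos 2 two_ne_zero, hE, ← exp_nat_mul]; norm_num
  have hF_neg_two : F (-2) = G 2 := hF_neg 2 two_ne_zero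
  have hX₀ : exp (3 * (2 * n)) = s ^ 2 := by simpa using hexp 0
  have hX₁ : exp (3 * (2 * n + 2)) = s ^ 2 * E ^ 2 := by simpa using hexp 1
  have hX₂ : exp (3 * (2 * n + 4)) = s ^ 2 * E ^ 4 := by
    have := hexp 2; norm_num at this; exact this
  have hG_two : 0 ≤ G 2 ∧ G 2 ≤ E / 2 := by
    have hX : exp (3 * 2) = E ^ 2 := by rw [hE, ← exp_nat_mul]; norm_num
    have e : G 2 = E / 2 * entryFactor E (E ^ 2) := by
      simp only [G, hX]; field_simp
    obtain ⟨-, h₀, h₁⟩ := entryFactor_bounds (by linarith : 2 ≤ E) le_rfl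
    rw [e]
    exact ⟨by positivity, mul_le_of_le_one_right (by positivity) h₁⟩
  have hE1 : 1 ≤ E := by linarith
  have hGA : G (2 * n) = s ^ 2 / (2 * E) * (entryFactor E (s ^ 2) / n) := by
    simp only [G, hX₀]; field_simp
  have hGB : G (2 * n + 2)
      = s ^ 2 / (2 * E) * E ^ 2 * (entryFactor E (s ^ 2 * E ^ 2) / (n + 1)) := by
    simp only [G, hX₁]; field_simp
  have hGC : G (2 * n + 4)
      = s ^ 2 / (2 * E) * E ^ 4 * (entryFactor E (s ^ 2 * E ^ 4) / (n + 2)) := by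
    have : (2 * (n : ℝ) + 4) = 2 * (n + 2) := by ring
    simp only [G, hX₂]; rw [this]; field_simp
  have hF_zero_abs : |F 0| ≤ 5.702 := by
    have h₁ : 6 / E ≤ 6 := div_le_self (by norm_num) hE1
    have h₂ : 0.298 ≤ 6 / E := by rw [le_div_iff₀ hE0]; linarith
    rw [hF_zero, abs_of_nonpos (by linarith)]
    linarith
  refine Matrix.PosDef.of_dotProduct_mulVec_pos ?_ ?_
  · ext i j
    fin_cases i <;> fin_cases j <;> simp [hM]
  · intro x hx
    have hne : s * x 0 ≠ 0 ∨ s * E ^ 2 * x 1 ≠ 0 ∨ x 2 ≠ 0 ∨ x 3 ≠ 0 := by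
      by_contra! h
      apply hx
      obtain ⟨h₀, h₁, h₂, h₃⟩ := h
      have h₀' : x 0 = 0 := by simpa [hs0.ne'] using h₀
      have h₁' : x 1 = 0 := by simpa [hs0.ne', hE0.ne'] using h₁
      ext i
      fin_cases i <;> assumption
    refine (scaled_form_pos hn0 hE₁ hE₂ hsN hF_zero_abs hG_two hGA hGB hGC hne).trans_eq ?_
    have hP₀ := hF_pos (2 * n) (by positivity)
    have hP₁ := hF_pos (2 * n + 2) (by positivity)
    have hP₂ := hF_pos (2 * n + 4) (by positivity)
    have hN₀ := hF_neg (2 * n) (by positivity)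
    have hN₁ := hF_neg (2 * n + 2) (by positivity)
    have hN₂ := hF_neg (2 * n + 4) (by positivity)
    rw [hX₀] at hP₀
    rw [hX₁] at hP₁
    rw [hX₂] at hP₂
    rw [neg_add'] at hN₁ hN₂
    have hmat : exp (-3) • (M (-1) + M 1) - (2 : ℝ) • M 0 =
        !![F (2 * n), F (2 * n + 2), F 0, F (-2);
           F (2 * n + 2), F (2 * n + 4), F 2, F 0;
           F 0, F 2, F (-(2 * n)), F (-(2 * n) - 2);
           F (-2), F 0, F (-(2 * n) - 2), F (-(2 * n) - 4)] := by
      ext i j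
      fin_cases i <;> fin_cases j <;> simp [hM, F]
    rw [hmat, hP₀, hP₁, hP₂, hN₀, hN₁, hN₂, hF_two, hF_neg_two]
    simp only [dotProduct, mulVec, Fin.sum_univ_four, star_trivial, of_apply, cons_val]
    field_simp
    ring
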